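/- The group Sp(4, F_2) of 4x4 symplectic matrices over the field with two elements is isomorphic to the symmetric group S_6 on six letters; in particular it has order 720. -/

import Mathlib

open Matrix

/-- The standard symplectic form matrix `((0, I₂), (-I₂, 0))`. -/
def J4 (R : Type) [CommRing R] : Matrix (Fin 2 ⊕ Fin 2) (Fin 2 ⊕ Fin 2) R :=
  Matrix.fromBlocks 0 1 (-1) 0
/-- The symplectic group `Sp(4, R)`. -/
def Sp4 (R : Type) [CommRing R] : Subgroup (GL (Fin 2 ⊕ Fin 2) R) where
  carrier := {g | (g : Matrix (Fin 2 ⊕ Fin 2) (Fin 2 ⊕ Fin 2) R) * J4 R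
      * (g : Matrix (Fin 2 ⊕ Fin 2) (Fin 2 ⊕ Fin 2) R)ᵀ = J4 R}
  one_mem' := by simp
  mul_mem' := by
    intro a b ha hb
    have hab : ((a * b : GL (Fin 2 ⊕ Fin 2) R) : Matrix (Fin 2 ⊕ Fin 2) (Fin 2 ⊕ Fin 2) R)
        = (a : Matrix (Fin 2 ⊕ Fin 2) (Fin 2 ⊕ Fin 2) R) * b := rfl
    show _ * J4 R * _ = J4 R
    rw [hab, transpose_mul]
    calc (a : Matrix (Fin 2 ⊕ Fin 2) (Fin 2 ⊕ Fin 2) R) * b * J4 R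
          * ((b : Matrix (Fin 2 ⊕ Fin 2) (Fin 2 ⊕ Fin 2) R)ᵀ * (a : Matrix (Fin 2 ⊕ Fin 2) (Fin 2 ⊕ Fin 2) R)ᵀ)
        = (a : Matrix (Fin 2 ⊕ Fin 2) (Fin 2 ⊕ Fin 2) R)
            * ((b : Matrix (Fin 2 ⊕ Fin 2) (Fin 2 ⊕ Fin 2) R) * J4 R * (b : Matrix (Fin 2 ⊕ Fin 2) (Fin 2 ⊕ Fin 2) R)ᵀ)
            * (a : Matrix (Fin 2 ⊕ Fin 2) (Fin 2 ⊕ Fin 2) R)ᵀ := by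
          simp only [Matrix.mul_assoc]
      _ = J4 R := by rw [hb]; exact ha
  inv_mem' := by
    intro a h
    have hBA : ((a⁻¹ : GL (Fin 2 ⊕ Fin 2) R) : Matrix (Fin 2 ⊕ Fin 2) (Fin 2 ⊕ Fin 2) R)
        * (a : Matrix (Fin 2 ⊕ Fin 2) (Fin 2 ⊕ Fin 2) R) = 1 := a.inv_mul
    show _ * J4 R * _ = J4 R
    conv_lhs => rw [← h]
    calc ((a⁻¹ : GL (Fin 2 ⊕ Fin 2) R) : Matrix (Fin 2 ⊕ Fin 2) (Fin 2 ⊕ Fin 2) R)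
          * ((a : Matrix (Fin 2 ⊕ Fin 2) (Fin 2 ⊕ Fin 2) R) * J4 R * (a : Matrix (Fin 2 ⊕ Fin 2) (Fin 2 ⊕ Fin 2) R)ᵀ)
          * ((a⁻¹ : GL (Fin 2 ⊕ Fin 2) R) : Matrix (Fin 2 ⊕ Fin 2) (Fin 2 ⊕ Fin 2) R)ᵀ
        = (((a⁻¹ : GL (Fin 2 ⊕ Fin 2) R) : Matrix (Fin 2 ⊕ Fin 2) (Fin 2 ⊕ Fin 2) R)
            * (a : Matrix (Fin 2 ⊕ Fin 2) (Fin 2 ⊕ Fin 2) R)) * J4 R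
            * ((a : Matrix (Fin 2 ⊕ Fin 2) (Fin 2 ⊕ Fin 2) R)ᵀ
              * ((a⁻¹ : GL (Fin 2 ⊕ Fin 2) R) : Matrix (Fin 2 ⊕ Fin 2) (Fin 2 ⊕ Fin 2) R)ᵀ) := by
          simp only [Matrix.mul_assoc]
      _ = J4 R := by rw [hBA, ← transpose_mul, hBA]; simp

/-- Six vectors of `F₂⁴` with sum zero. Every nonzero vector is `hexad i + hexad j` for a unique
pair `{i, j}`, and the symplectic form counts the common points of two pairs modulo `2`. -/
def hexad : Fin 6 → Fin 2 ⊕ Fin 2 → ZMod 2 :=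
  ![Sum.elim ![0, 1] ![1, 0], Sum.elim ![1, 1] ![1, 0], Sum.elim ![1, 1] ![0, 0],
    Sum.elim ![0, 1] ![0, 1], Sum.elim ![0, 0] ![0, 1], Sum.elim ![0, 0] ![0, 0]]

/-- The first point of the pair representing a standard basis vector. -/
def basisFst : Fin 2 ⊕ Fin 2 → Fin 6 := Sum.elim ![0, 3] ![1, 4]

/-- The second point of the pair representing a standard basis vector. -/
def basisSnd : Fin 2 ⊕ Fin 2 → Fin 6 := Sum.elim ![1, 4] ![2, 5]

/-- The bilinear form on row vectors given by `J4`. -/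
def sympForm (x y : Fin 2 ⊕ Fin 2 → ZMod 2) : ZMod 2 := x ᵥ* J4 (ZMod 2) ⬝ᵥ y

theorem sympForm_eq (x y : Fin 2 ⊕ Fin 2 → ZMod 2) :
    sympForm x y = x (.inl 0) * y (.inr 0) + x (.inl 1) * y (.inr 1)
      + x (.inr 0) * y (.inl 0) + x (.inr 1) * y (.inl 1) := by
  simp [sympForm, J4, vecMul, dotProduct, Matrix.one_apply, CharTwo.neg_eq]
  ring

theorem mul_J4_mul_transpose_apply (A : Matrix (Fin 2 ⊕ Fin 2) (Fin 2 ⊕ Fin 2) (ZMod 2))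
    (k l : Fin 2 ⊕ Fin 2) : (A * J4 (ZMod 2) * Aᵀ) k l = sympForm (A k) (A l) := rfl

theorem sympForm_vecMul {A : Matrix (Fin 2 ⊕ Fin 2) (Fin 2 ⊕ Fin 2) (ZMod 2)}
    (hA : A * J4 (ZMod 2) * Aᵀ = J4 (ZMod 2)) (x y : Fin 2 ⊕ Fin 2 → ZMod 2) :
    sympForm (x ᵥ* A) (y ᵥ* A) = sympForm x y := by
  conv_rhs => rw [sympForm, ← hA, ← vecMul_vecMul, ← vecMul_vecMul, ← dotProduct_mulVec _ Aᵀ y,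
    mulVec_transpose]
  rfl

theorem hexad_add_hexad_basis (k : Fin 2 ⊕ Fin 2) :
    hexad (basisFst k) + hexad (basisSnd k) = Pi.single k 1 := by
  revert k; decide

theorem sum_hexad : ∑ i, hexad i = 0 := by decide

theorem hexad_five : hexad 5 = 0 := by decide

theorem hexad_injective : Function.Injective hexad := by decide

theorem sympForm_hexad (i j : Fin 6) :
    sympForm (hexad i) (hexad j) = if i = j ∨ i = 5 ∨ j = 5 then 0 else 1 := by
  rw [sympForm_eq]
  revert i j; decide

theorem sympForm_add_left (x y z : Fin 2 ⊕ Fin 2 → ZMod 2) :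
    sympForm (x + y) z = sympForm x z + sympForm y z := by
  simp [sympForm, add_vecMul]

theorem sympForm_add_right (x y z : Fin 2 ⊕ Fin 2 → ZMod 2) :
    sympForm x (y + z) = sympForm x y + sympForm x z := by
  simp [sympForm]

theorem sympForm_hexad_add (i j k l : Fin 6) :
    sympForm (hexad i + hexad j) (hexad k + hexad l) =
      (if i = k then 1 else 0) + (if i = l then 1 else 0) +
        (if j = k then 1 else 0) + (if j = l then 1 else 0) := by
  simp only [sympForm_add_left, sympForm_add_right, sympForm_hexad]
  revert i j k l; decide

theorem exists_hexad_of_sympForm_eq_one (x y : Fin 2 ⊕ Fin 2 → ZMod 2) (h : sympForm x y = 1) :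
    ∃ t p q, x = hexad p + hexad t ∧ y = hexad q + hexad t := by
  rw [sympForm_eq] at h
  revert x y; decide

theorem eq_add_or_exists_hexad (t p q : Fin 6) (x : Fin 2 ⊕ Fin 2 → ZMod 2)
    (hpq : sympForm (hexad p + hexad t) (hexad q + hexad t) = 1)
    (hp : sympForm (hexad p + hexad t) x = 1) (hq : sympForm (hexad q + hexad t) x = 1) :
    x = (hexad p + hexad t) + (hexad q + hexad t) ∨ ∃ r, x = hexad r + hexad t := by
  rw [sympForm_eq] at *
  revert t p q x; decide

theorem eq_or_eq_of_hexad_add_eq (a b i j : Fin 6) (hij : i ≠ j)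
    (h : hexad a + hexad b = hexad i + hexad j) : a = i ∨ a = j := by
  revert a b i j; decide

theorem perm_eq_one_of_hexad_add_eq (σ : Equiv.Perm (Fin 6))
    (h : ∀ i j, hexad (σ i) + hexad (σ j) = hexad i + hexad j) : σ = 1 := by
  ext1 i
  obtain ⟨j, k, hij, hik, hjk⟩ : ∃ j k : Fin 6, i ≠ j ∧ i ≠ k ∧ j ≠ k := by
    revert i; decide
  have hj := eq_or_eq_of_hexad_add_eq _ _ i j hij (h i j)
  have hk := eq_or_eq_of_hexad_add_eq _ _ i k hik (h i k)
  rw [Equiv.Perm.one_apply]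
  grind

theorem sum_hexad_mul_eq (y : Fin 6 → ZMod 2) (hy : ∑ i, y i = 0) (i : Fin 6) :
    ∑ k, hexad i k * (y (basisFst k) + y (basisSnd k)) = y i + y 5 := by
  revert y i; decide

/-- The matrix of the linear map sending `hexad i + hexad j` to
`hexad (σ⁻¹ i) + hexad (σ⁻¹ j)`, acting on row vectors. -/
def hexadMatrix (σ : Equiv.Perm (Fin 6)) : Matrix (Fin 2 ⊕ Fin 2) (Fin 2 ⊕ Fin 2) (ZMod 2) :=
  Matrix.of fun k => hexad (σ⁻¹ (basisFst k)) + hexad (σ⁻¹ (basisSnd k))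

theorem hexad_vecMul_hexadMatrix (σ : Equiv.Perm (Fin 6)) (i : Fin 6) :
    hexad i ᵥ* hexadMatrix σ = hexad (σ⁻¹ i) + hexad (σ⁻¹ 5) := by
  ext l
  refine sum_hexad_mul_eq (fun j => hexad (σ⁻¹ j) l) ?_ i
  rw [Equiv.sum_comp σ⁻¹ fun j => hexad j l, ← Finset.sum_apply, sum_hexad, Pi.zero_apply]

theorem hexad_add_vecMul_hexadMatrix (σ : Equiv.Perm (Fin 6)) (i j : Fin 6) :
    (hexad i + hexad j) ᵥ* hexadMatrix σ = hexad (σ⁻¹ i) + hexad (σ⁻¹ j) := by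
  rw [add_vecMul, hexad_vecMul_hexadMatrix, hexad_vecMul_hexadMatrix, add_add_add_comm,
    CharTwo.add_self_eq_zero, add_zero]

theorem hexadMatrix_mul_J4_mul_transpose (σ : Equiv.Perm (Fin 6)) :
    hexadMatrix σ * J4 (ZMod 2) * (hexadMatrix σ)ᵀ = J4 (ZMod 2) := by
  ext k l
  have hJ : J4 (ZMod 2) k l = sympForm (Pi.single k 1) (Pi.single l 1) := by simp [sympForm]
  rw [mul_J4_mul_transpose_apply, hJ, ← hexad_add_hexad_basis, ← hexad_add_hexad_basis,
    sympForm_hexad_add]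
  refine (sympForm_hexad_add _ _ _ _).trans ?_
  simp only [σ⁻¹.injective.eq_iff]

/-- The action of `S₆` on `F₂⁴`, as a homomorphism to matrices. -/
def hexadMatrixHom :
    Equiv.Perm (Fin 6) →* Matrix (Fin 2 ⊕ Fin 2) (Fin 2 ⊕ Fin 2) (ZMod 2) where
  toFun := hexadMatrix
  map_one' := by
    ext k : 1
    simp [hexadMatrix, hexad_add_hexad_basis, Matrix.one_eq_pi_single]
  map_mul' σ τ := by
    funext k
    exact (hexad_add_vecMul_hexadMatrix τ _ _).symm

/-- The action of `S₆` on `F₂⁴`, as a homomorphism to the symplectic group. -/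
def permToSp4 : Equiv.Perm (Fin 6) →* Sp4 (ZMod 2) :=
  hexadMatrixHom.toHomUnits.codRestrict _ hexadMatrix_mul_J4_mul_transpose

theorem permToSp4_injective : Function.Injective permToSp4 := by
  rw [injective_iff_map_eq_one]
  intro σ hσ
  have hM : hexadMatrix σ = 1 := congrArg (fun g : Sp4 (ZMod 2) => g.1.1) hσ
  refine inv_eq_one.1 (perm_eq_one_of_hexad_add_eq σ⁻¹ fun i j => ?_)
  rw [← hexad_add_vecMul_hexadMatrix, hM, vecMul_one]

theorem permToSp4_surjective : Function.Surjective permToSp4 := by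
  rintro ⟨g, hg : g.1 * J4 (ZMod 2) * g.1ᵀ = J4 (ZMod 2)⟩
  have hinj : Function.Injective (· ᵥ* g.1) := vecMul_injective_of_isUnit g.isUnit
  have hform : ∀ i j, i ≠ j → i ≠ 5 → j ≠ 5 →
      sympForm (hexad i ᵥ* g.1) (hexad j ᵥ* g.1) = 1 := by
    intro i j hij hi hj
    rw [sympForm_vecMul hg, sympForm_hexad, if_neg (by simp [*])]
  obtain ⟨t, p, q, hp, hq⟩ :=
    exists_hexad_of_sympForm_eq_one _ _ (hform 0 1 (by decide) (by decide) (by decide))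
  have hex : ∀ i, ∃ j, hexad i ᵥ* g.1 = hexad j + hexad t := by
    intro i
    by_cases h0 : i = 0
    · exact ⟨p, h0 ▸ hp⟩
    by_cases h1 : i = 1
    · exact ⟨q, h1 ▸ hq⟩
    by_cases h5 : i = 5
    · exact ⟨t, by rw [h5, hexad_five, zero_vecMul, CharTwo.add_self_eq_zero]⟩
    refine (eq_add_or_exists_hexad t p q _ ?_ ?_ ?_).resolve_left ?_
    · rw [← hp, ← hq]; exact hform 0 1 (by decide) (by decide) (by decide)
    · rw [← hp]; exact hform 0 i (Ne.symm h0) (by decide) h5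
    · rw [← hq]; exact hform 1 i (Ne.symm h1) (by decide) h5
    · rw [← hp, ← hq, ← add_vecMul]
      intro h
      have h' : hexad i = hexad 0 + hexad 1 := hinj h
      clear h hform
      revert i; decide
  choose f hf using hex
  have hfinj : Function.Injective f := by
    intro i j hij
    apply hexad_injective
    apply hinj
    simp only [hf, hij]
  let σ : Equiv.Perm (Fin 6) := Equiv.ofBijective f (Finite.injective_iff_bijective.1 hfinj)
  refine ⟨σ⁻¹, Subtype.ext (Units.ext ?_)⟩
  change hexadMatrix σ⁻¹ = g.1
  funext k
  calc hexadMatrix σ⁻¹ k = hexad (f (basisFst k)) + hexad (f (basisSnd k)) := rfl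
    _ = (hexad (basisFst k) + hexad (basisSnd k)) ᵥ* g.1 := by
      rw [add_vecMul, hf, hf, add_add_add_comm, CharTwo.add_self_eq_zero, add_zero]
    _ = g.1 k := by rw [hexad_add_hexad_basis, single_one_vecMul]; rfl

/-- `Sp(4, F₂)` is isomorphic to the symmetric group `S₆`; in particular it has
order `720`. -/
theorem sp4_f2_iso_s6 :
    Nonempty (Sp4 (ZMod 2) ≃* Equiv.Perm (Fin 6)) ∧
    Nat.card (Sp4 (ZMod 2)) = 720 := by
  let e : Equiv.Perm (Fin 6) ≃* Sp4 (ZMod 2) :=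
    MulEquiv.ofBijective permToSp4 ⟨permToSp4_injective, permToSp4_surjective⟩
  refine ⟨⟨e.symm⟩, ?_⟩
  rw [← Nat.card_congr e.toEquiv, Nat.card_perm, Nat.card_fin]
  rfl
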